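/- Let T be an abelian group (written multiplicatively), I an index type with at least two elements, and (T_i)_{i ∈ I} a family of nontrivial subgroups of T satisfying: (a) for pairwise distinct i, j, k ∈ I one has (T_i * T_j) ∩ T_k = {1}; (b) T is generated by the union of the T_i; (c) for all distinct i, j ∈ I and all a ∈ T_i \ {1}, b ∈ T_j \ {1}, there exist distinct k, l ∈ I with {k, l} ∩ {i, j} = ∅ and elements c ∈ T_k \ {1}, d ∈ T_l \ {1} such that a * b = c * d. If β is a group endomorphism of T with β(T_i) ⊆ T_i for all i ∈ I, and β(ℓ₀) = 1 for some ℓ₀ ≠ 1 lying in some T_{i₀}, then β is the trivial endomorphism, i.e., β(t) = 1 for all t ∈ T. -/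

import Mathlib

open scoped Pointwise

/-- An endomorphism preserving every `Ts i` that kills a nonidentity element of `Ts i`
is trivial on `Ts j` for every `j ≠ i`. -/
theorem map_eq_one_of_mem_of_ne
    {T : Type*} [CommGroup T] {I : Type*} {Ts : I → Subgroup T}
    (ha : ∀ i j k : I, i ≠ j → j ≠ k → i ≠ k →
      ((Ts i : Set T) * (Ts j : Set T)) ∩ (Ts k : Set T) = {1})
    (hc : ∀ i j : I, i ≠ j → ∀ a ∈ Ts i, a ≠ 1 → ∀ b ∈ Ts j, b ≠ 1 →
      ∃ k l : I, k ≠ l ∧ k ≠ i ∧ k ≠ j ∧ l ≠ i ∧ l ≠ j ∧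
        ∃ c ∈ Ts k, c ≠ 1 ∧ ∃ d ∈ Ts l, d ≠ 1 ∧ a * b = c * d)
    {β : T →* T} (hβ : ∀ i : I, ∀ x ∈ Ts i, β x ∈ Ts i)
    {i j : I} (hij : i ≠ j) {a : T} (hai : a ∈ Ts i) (ha1 : a ≠ 1) (hβa : β a = 1)
    {b : T} (hbj : b ∈ Ts j) : β b = 1 := by
  by_cases hb1 : b = 1
  · rw [hb1, map_one]
  obtain ⟨k, l, hkl, -, hkj, -, hlj, c, hck, -, d, hdl, -, h⟩ := hc i j hij a hai ha1 b hbj hb1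
  have hβb : β c * β d = β b := by
    rw [← map_mul, ← h, map_mul, hβa, one_mul]
  have hmem : β b ∈ ((Ts k : Set T) * (Ts l : Set T)) ∩ (Ts j : Set T) :=
    ⟨Set.mem_mul.2 ⟨β c, hβ k c hck, β d, hβ l d hdl, hβb⟩, hβ j b hbj⟩
  rwa [ha k l j hkl hlj hkj] at hmem

/-- In a multiplicative abelian group `T` with a family of nontrivial
subgroups `Ts i` (indexed by a type `I` with at least two elements) satisfying the
Kantor-family style conditions (a), (b), (c), any group endomorphism `β` of `T`
mapping every `Ts i` into itself and killing some nonidentity element of some `Ts i₀`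
is the trivial endomorphism. -/
theorem kantor_kernel_injective
    {T : Type*} [CommGroup T] {I : Type*}
    (Ts : I → Subgroup T)
    (hI : ∃ i j : I, i ≠ j)
    (hnontriv : ∀ i, Ts i ≠ ⊥)
    -- (a) for pairwise distinct i, j, k : (T_i * T_j) ∩ T_k = {1}
    (ha : ∀ i j k : I, i ≠ j → j ≠ k → i ≠ k →
      ((Ts i : Set T) * (Ts j : Set T)) ∩ (Ts k : Set T) = {1})
    -- (b) T is generated by the union of the T_i
    (hb : Subgroup.closure (⋃ i, (Ts i : Set T)) = ⊤)
    -- (c) thickness condition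
    (hc : ∀ i j : I, i ≠ j → ∀ a ∈ Ts i, a ≠ 1 → ∀ b ∈ Ts j, b ≠ 1 →
      ∃ k l : I, k ≠ l ∧ k ≠ i ∧ k ≠ j ∧ l ≠ i ∧ l ≠ j ∧
        ∃ c ∈ Ts k, c ≠ 1 ∧ ∃ d ∈ Ts l, d ≠ 1 ∧ a * b = c * d)
    (β : T →* T)
    (hβ : ∀ i : I, ∀ x ∈ Ts i, β x ∈ Ts i)
    (hkill : ∃ i₀ : I, ∃ ℓ₀ ∈ Ts i₀, ℓ₀ ≠ 1 ∧ β ℓ₀ = 1) :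
    ∀ t : T, β t = 1 := by
  obtain ⟨i₀, a, ha₀, ha1, hβa⟩ := hkill
  have : Nontrivial I := ⟨hI⟩
  obtain ⟨j, hj⟩ := exists_ne i₀
  obtain ⟨b, hbj, hb1⟩ := (Ts j).bot_or_exists_ne_one.resolve_left (hnontriv j)
  have hβb : β b = 1 := map_eq_one_of_mem_of_ne ha hc hβ hj.symm ha₀ ha1 hβa hbj
  have hle : Subgroup.closure (⋃ i, (Ts i : Set T)) ≤ β.ker := by
    rw [Subgroup.closure_le]
    refine Set.iUnion_subset fun i x hx => MonoidHom.mem_ker.2 ?_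
    by_cases hi : i₀ = i
    · subst hi
      exact map_eq_one_of_mem_of_ne ha hc hβ hj hbj hb1 hβb hx
    · exact map_eq_one_of_mem_of_ne ha hc hβ hi ha₀ ha1 hβa hx
  intro t
  exact MonoidHom.mem_ker.1 (hle (hb ▸ Subgroup.mem_top t))
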